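/- Let Y, Q, Z be random variables on a common probability space, each taking values in a finite nonempty set, with no further assumptions on their joint distribution. Then |I(Y;Z) − I(Q;Z)| ≤ H(Y | Q) + H(Q | Y). -/

import Mathlib

/-!
Statement 1: For arbitrary finite random variables `Y, Q, Z` (no assumption on
the joint law), `|I(Y;Z) − I(Q;Z)| ≤ H(Y | Q) + H(Q | Y)`.
-/

open scoped BigOperators

noncomputable section

variable {Y Q Z : Type*} [Fintype Y] [Fintype Q] [Fintype Z]

/-- Marginal pmf of `Y`. -/
def margY (p : Y → Q → Z → ℝ) (y : Y) : ℝ := ∑ q, ∑ z, p y q z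

/-- Marginal pmf of `Q`. -/
def margQ (p : Y → Q → Z → ℝ) (q : Q) : ℝ := ∑ y, ∑ z, p y q z

/-- Marginal pmf of `Z`. -/
def margZ (p : Y → Q → Z → ℝ) (z : Z) : ℝ := ∑ y, ∑ q, p y q z

/-- Joint marginal pmf of `(Y, Q)`. -/
def margYQ (p : Y → Q → Z → ℝ) (y : Y) (q : Q) : ℝ := ∑ z, p y q z

/-- Joint marginal pmf of `(Q, Z)`. -/
def margQZ (p : Y → Q → Z → ℝ) (q : Q) (z : Z) : ℝ := ∑ y, p y q z

/-- Joint marginal pmf of `(Y, Z)`. -/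
def margYZ (p : Y → Q → Z → ℝ) (y : Y) (z : Z) : ℝ := ∑ q, p y q z

/-- Mutual information `I(Y;Z)`. -/
def miYZ (p : Y → Q → Z → ℝ) : ℝ :=
  ∑ y, ∑ z, margYZ p y z * Real.log (margYZ p y z / (margY p y * margZ p z))

/-- Mutual information `I(Q;Z)`. -/
def miQZ (p : Y → Q → Z → ℝ) : ℝ :=
  ∑ q, ∑ z, margQZ p q z * Real.log (margQZ p q z / (margQ p q * margZ p z))

/-- Conditional entropy `H(Q|Y) = −Σ_{y,q} p(y,q) log p(q|y)`. -/
def condEntQgivenY (p : Y → Q → Z → ℝ) : ℝ :=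
  -∑ y, ∑ q, margYQ p y q * Real.log (margYQ p y q / margY p y)

/-- Conditional entropy `H(Y|Q) = −Σ_{y,q} p(y,q) log p(y|q)`. -/
def condEntYgivenQ (p : Y → Q → Z → ℝ) : ℝ :=
  -∑ y, ∑ q, margYQ p y q * Real.log (margYQ p y q / margQ p q)

theorem mul_log_ratio_le_sub {p a b c d e f : ℝ} (hp : 0 ≤ p) (hpa : p ≤ a) (hab : a ≤ b)
    (hac : a ≤ c) (hpd : p ≤ d) (hde : d ≤ e) (hpf : p ≤ f) :
    p * Real.log (a / (b * c)) - p * Real.log (d / (e * c)) + p * Real.log (f / e)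
      ≤ a * (f / b) - p := by
  rcases hp.eq_or_lt with rfl | hp
  · have : 0 ≤ a * (f / b) := by
      have : 0 ≤ b := hpa.trans hab
      positivity
    simpa using this
  · have ha : 0 < a := by linarith
    have hb : 0 < b := by linarith
    have hc : 0 < c := by linarith
    have hd : 0 < d := by linarith
    have he : 0 < e := by linarith
    have hf : 0 < f := by linarith
    have key := Real.log_le_sub_one_of_pos (show 0 < a * f / (b * p) by positivity)
    have hlog := Real.log_le_log hp hpd
    rw [Real.log_div (by positivity) (by positivity), Real.log_mul ha.ne' hf.ne',
      Real.log_mul hb.ne' hp.ne'] at key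
    rw [Real.log_div ha.ne' (by positivity), Real.log_div hd.ne' (by positivity),
      Real.log_div hf.ne' he.ne', Real.log_mul hb.ne' hc.ne', Real.log_mul he.ne' hc.ne']
    have hmul := mul_le_mul_of_nonneg_left (key.trans' (by linarith :
      Real.log a - Real.log b - Real.log d + Real.log f ≤ _)) hp.le
    have heq : p * (a * f / (b * p) - 1) = a * (f / b) - p := by
      field_simp
    linarith

omit [Fintype Q] in
theorem margYQ_le_margQ (p : Y → Q → Z → ℝ) (hp : ∀ y q z, 0 ≤ p y q z) (y : Y) (q : Q) :
    margYQ p y q ≤ margQ p q :=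
  Finset.single_le_sum (f := fun y => ∑ z, p y q z)
    (fun y _ => Finset.sum_nonneg fun z _ => hp y q z) (Finset.mem_univ y)

theorem condEntYgivenQ_nonneg (p : Y → Q → Z → ℝ) (hp : ∀ y q z, 0 ≤ p y q z) :
    0 ≤ condEntYgivenQ p := by
  rw [condEntYgivenQ, neg_nonneg]
  refine Finset.sum_nonpos fun y _ => Finset.sum_nonpos fun q _ => ?_
  have h0 : 0 ≤ margYQ p y q := Finset.sum_nonneg fun z _ => hp y q z
  have hle := margYQ_le_margQ p hp y q
  exact mul_nonpos_of_nonneg_of_nonpos h0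
    (Real.log_nonpos (div_nonneg h0 (h0.trans hle)) (div_le_one_of_le₀ hle (h0.trans hle)))

theorem sum_margYZ_mul_margYQ_div_margY (p : Y → Q → Z → ℝ) :
    ∑ y, ∑ q, ∑ z, margYZ p y z * (margYQ p y q / margY p y) = ∑ y, ∑ q, ∑ z, p y q z := by
  refine Finset.sum_congr rfl fun y _ => ?_
  have hz : ∑ z, margYZ p y z = margY p y := Finset.sum_comm
  have hq : ∑ q, margYQ p y q = margY p y := rfl
  simp_rw [← Finset.sum_mul, hz, ← Finset.mul_sum, ← Finset.sum_div, hq]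
  exact mul_div_cancel_of_imp' fun h => h

/-- `I(Y;Z) − I(Q;Z) ≤ H(Y | Q)`. -/
theorem miYZ_sub_miQZ_le_condEntYgivenQ (p : Y → Q → Z → ℝ) (hp : ∀ y q z, 0 ≤ p y q z) :
    miYZ p - miQZ p ≤ condEntYgivenQ p := by
  have hYZ : miYZ p = ∑ y, ∑ q, ∑ z,
      p y q z * Real.log (margYZ p y z / (margY p y * margZ p z)) := by
    refine Finset.sum_congr rfl fun y _ => ?_
    rw [Finset.sum_comm]
    simp_rw [← Finset.sum_mul]
    rfl
  have hQZ : miQZ p = ∑ y, ∑ q, ∑ z,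
      p y q z * Real.log (margQZ p q z / (margQ p q * margZ p z)) := by
    rw [Finset.sum_comm]
    refine Finset.sum_congr rfl fun q _ => ?_
    rw [Finset.sum_comm]
    simp_rw [← Finset.sum_mul]
    rfl
  have hYQ : condEntYgivenQ p = -∑ y, ∑ q, ∑ z,
      p y q z * Real.log (margYQ p y q / margQ p q) := by
    simp_rw [← Finset.sum_mul]
    rfl
  have hterm : ∑ y, ∑ q, ∑ z, (p y q z * Real.log (margYZ p y z / (margY p y * margZ p z))
      - p y q z * Real.log (margQZ p q z / (margQ p q * margZ p z))
      + p y q z * Real.log (margYQ p y q / margQ p q))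
      ≤ ∑ y, ∑ q, ∑ z, (margYZ p y z * (margYQ p y q / margY p y) - p y q z) := by
    refine Finset.sum_le_sum fun y _ => Finset.sum_le_sum fun q _ =>
      Finset.sum_le_sum fun z _ => mul_log_ratio_le_sub (hp y q z) ?_ ?_ ?_ ?_ ?_ ?_
    · exact Finset.single_le_sum (f := fun q => p y q z) (fun q _ => hp y q z)
        (Finset.mem_univ q)
    · exact Finset.sum_le_sum fun q _ => Finset.single_le_sum (f := fun z => p y q z)
        (fun z _ => hp y q z) (Finset.mem_univ z)
    · exact Finset.single_le_sum (f := fun y => ∑ q, p y q z)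
        (fun y _ => Finset.sum_nonneg fun q _ => hp y q z) (Finset.mem_univ y)
    · exact Finset.single_le_sum (f := fun y => p y q z) (fun y _ => hp y q z)
        (Finset.mem_univ y)
    · exact Finset.sum_le_sum fun y _ => Finset.single_le_sum (f := fun z => p y q z)
        (fun z _ => hp y q z) (Finset.mem_univ z)
    · exact Finset.single_le_sum (f := fun z => p y q z) (fun z _ => hp y q z)
        (Finset.mem_univ z)
  simp only [Finset.sum_add_distrib, Finset.sum_sub_distrib] at hterm
  rw [sum_margYZ_mul_margYQ_div_margY, sub_self] at hterm
  rw [hYZ, hQZ, hYQ]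
  linarith

omit [Fintype Z] in
theorem margZ_swap (p : Y → Q → Z → ℝ) : margZ (fun q y z => p y q z) = margZ p :=
  funext fun _ => Finset.sum_comm

theorem miYZ_swap (p : Y → Q → Z → ℝ) : miYZ (fun q y z => p y q z) = miQZ p := by
  unfold miYZ miQZ
  rw [margZ_swap]
  rfl

theorem miQZ_swap (p : Y → Q → Z → ℝ) : miQZ (fun q y z => p y q z) = miYZ p := by
  unfold miYZ miQZ
  rw [margZ_swap]
  rfl

theorem condEntYgivenQ_swap (p : Y → Q → Z → ℝ) :
    condEntYgivenQ (fun q y z => p y q z) = condEntQgivenY p :=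
  congrArg Neg.neg Finset.sum_comm

/-- For arbitrary joint distributions,
`|I(Y;Z) − I(Q;Z)| ≤ H(Y | Q) + H(Q | Y)`. -/
theorem abs_mi_diff_le_condEnt_add_condEnt
    [Nonempty Y] [Nonempty Q] [Nonempty Z]
    (p : Y → Q → Z → ℝ)
    (hp : ∀ y q z, 0 ≤ p y q z)
    (hsum : ∑ y, ∑ q, ∑ z, p y q z = 1) :
    |miYZ p - miQZ p| ≤ condEntYgivenQ p + condEntQgivenY p := by
  have hY := miYZ_sub_miQZ_le_condEntYgivenQ p hp
  have hQ := miYZ_sub_miQZ_le_condEntYgivenQ (fun q y z => p y q z) fun q y z => hp y q z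
  have hY0 := condEntYgivenQ_nonneg p hp
  have hQ0 := condEntYgivenQ_nonneg (fun q y z => p y q z) fun q y z => hp y q z
  rw [condEntYgivenQ_swap] at hQ hQ0
  rw [miYZ_swap, miQZ_swap p] at hQ
  exact abs_le.2 ⟨by linarith, by linarith⟩
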